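/- For probability distributions P and Q over bit functions, there exists a free operation μ with Γ_μ(P) = Q if and only if the following three inequalities hold: (i) Q(I) + Q(F) ≤ P(I) + P(F); (ii) |Q(I) − Q(F)| · (P(I) + P(F)) ≤ |P(I) − P(F)| · (Q(I) + Q(F)); (iii) (Q(I) + Q(F)) · (1 − |P(R0) − P(R1)|) ≤ (P(I) + P(F)) · (1 − |Q(R0) − Q(R1)|). That is, the three monotones M_β, M_{|α|} and M_{|γ|,β} form a complete set of monotones for the bit-to-bit Resource Theory of Knowledge of Causal Influence. -/

import Mathlib

open Finset

/-- `P` is a probability distribution over the four bit functions. -/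
def IsDist (P : (Bool → Bool) → ℝ) : Prop :=
  (∀ f, 0 ≤ P f) ∧ ∑ f : Bool → Bool, P f = 1

/-- `μ` is a probability distribution over pairs (pre-processing, post-processing),
specifying a free operation. -/
def IsFreeOp (μ : ((Bool → Bool) × (Bool → Bool)) → ℝ) : Prop :=
  (∀ gh, 0 ≤ μ gh) ∧ ∑ gh : (Bool → Bool) × (Bool → Bool), μ gh = 1

/-- The action `Γ_μ` of a free operation `μ` on a distribution `P` over bit functions:
`Γ_μ(P)(f') = ∑_{(g,h)} μ(g,h) · ∑_{f : h ∘ f ∘ g = f'} P(f)`. -/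
noncomputable def Gamma (μ : ((Bool → Bool) × (Bool → Bool)) → ℝ)
    (P : (Bool → Bool) → ℝ) : (Bool → Bool) → ℝ :=
  fun f' => ∑ gh : (Bool → Bool) × (Bool → Bool),
    μ gh * ∑ f : Bool → Bool, if gh.2 ∘ f ∘ gh.1 = f' then P f else 0

/-- The identity bit function `I`. -/
def bitI : Bool → Bool := id
/-- The flip bit function `F`. -/
def bitF : Bool → Bool := fun b => !b
/-- The reset-to-zero bit function `R0`. -/
def bitR0 : Bool → Bool := fun _ => false
/-- The reset-to-one bit function `R1`. -/
def bitR1 : Bool → Bool := fun _ => true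

lemma sum_bit (G : (Bool → Bool) → ℝ) :
    ∑ f : Bool → Bool, G f = G bitI + G bitF + G bitR0 + G bitR1 := by
  have h : (Finset.univ : Finset (Bool → Bool)) = {bitI, bitF, bitR0, bitR1} := by decide
  rw [h, Finset.sum_insert (by decide), Finset.sum_insert (by decide),
    Finset.sum_insert (by decide), Finset.sum_singleton]
  ring

lemma cI1 (f : Bool → Bool) : bitI ∘ f = f := rfl
lemma cI2 (f : Bool → Bool) : f ∘ bitI = f := rfl
lemma c01 (f : Bool → Bool) : bitR0 ∘ f = bitR0 := rfl
lemma c11 (f : Bool → Bool) : bitR1 ∘ f = bitR1 := rfl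
lemma cFF : bitF ∘ bitF = bitI := by decide
lemma cF0 : bitF ∘ bitR0 = bitR1 := by decide
lemma cF1 : bitF ∘ bitR1 = bitR0 := by decide
lemma nIF : (bitI = bitF) = False := by decide
lemma nI0 : (bitI = bitR0) = False := by decide
lemma nI1 : (bitI = bitR1) = False := by decide
lemma nF0 : (bitF = bitR0) = False := by decide
lemma nF1 : (bitF = bitR1) = False := by decide
lemma n01 : (bitR0 = bitR1) = False := by decide
lemma nFI : (bitF = bitI) = False := by decide
lemma n0I : (bitR0 = bitI) = False := by decide
lemma n1I : (bitR1 = bitI) = False := by decide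
lemma n0F : (bitR0 = bitF) = False := by decide
lemma n1F : (bitR1 = bitF) = False := by decide
lemma n10 : (bitR1 = bitR0) = False := by decide

lemma split_abs (x A B : ℝ) (hA : 0 ≤ A) (hB : 0 ≤ B) (h : |x| ≤ A + B) :
    ∃ a b, x = a + b ∧ |a| ≤ A ∧ |b| ≤ B := by
  rw [abs_le] at h
  by_cases h1 : x ≤ -A
  · exact ⟨-A, x + A, by ring, by rw [abs_neg, abs_of_nonneg hA],
      by rw [abs_le]; constructor <;> linarith⟩
  by_cases h2 : A ≤ x
  · exact ⟨A, x - A, by ring, by rw [abs_of_nonneg hA],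
      by rw [abs_le]; constructor <;> linarith⟩
  · exact ⟨x, 0, by ring, by rw [abs_le]; constructor <;> linarith, by simpa using hB⟩

lemma factor_abs (a c : ℝ) (h : |a| ≤ |c|) : ∃ v, -1 ≤ v ∧ v ≤ 1 ∧ v * c = a := by
  by_cases hc : c = 0
  · subst hc
    refine ⟨0, by norm_num, by norm_num, ?_⟩
    have : a = 0 := by simpa using h
    simp [this]
  · refine ⟨a / c, ?_, ?_, by field_simp⟩
    all_goals
      have : |a / c| ≤ 1 := by
        rw [abs_div]; exact div_le_one_of_le₀ h (abs_nonneg _)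
      rw [abs_le] at this
      linarith [this.1, this.2]

set_option maxHeartbeats 4000000 in
/-- the three monotones `M_β`, `M_{|α|}` and `M_{|γ|,β}` form a
complete set of monotones: `P` can be converted to `Q` by a free operation iff
the three (cross-multiplied) monotone inequalities hold. -/
theorem stmt_5 (P Q : (Bool → Bool) → ℝ) (hP : IsDist P) (hQ : IsDist Q) :
    (∃ μ, IsFreeOp μ ∧ Gamma μ P = Q) ↔
      (Q bitI + Q bitF ≤ P bitI + P bitF ∧
       |Q bitI - Q bitF| * (P bitI + P bitF) ≤ |P bitI - P bitF| * (Q bitI + Q bitF) ∧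
       (Q bitI + Q bitF) * (1 - |P bitR0 - P bitR1|)
         ≤ (P bitI + P bitF) * (1 - |Q bitR0 - Q bitR1|)) := by
  obtain ⟨hP0, hP1⟩ := hP
  obtain ⟨hQ0, hQ1⟩ := hQ
  rw [sum_bit] at hP1 hQ1
  have pI := hP0 bitI
  have pF := hP0 bitF
  have p0 := hP0 bitR0
  have p1 := hP0 bitR1
  have qI := hQ0 bitI
  have qF := hQ0 bitF
  have q0 := hQ0 bitR0
  have q1 := hQ0 bitR1
  constructor
  · rintro ⟨μ, ⟨hμ0, hμ1⟩, hG⟩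
    have eI := congrFun hG bitI
    have eF := congrFun hG bitF
    have e0 := congrFun hG bitR0
    have e1 := congrFun hG bitR1
    clear hG
    simp only [Gamma, Fintype.sum_prod_type, sum_bit, cI1, cI2, c01, c11, cFF, cF0, cF1,
      nIF, nI0, nI1, nF0, nF1, n01, nFI, n0I, n1I, n0F, n1F, n10, if_true, if_false,
      add_zero, zero_add, mul_zero] at eI eF e0 e1 hμ1
    have a1 := hμ0 (bitI, bitI)
    have a2 := hμ0 (bitF, bitF)
    have a3 := hμ0 (bitI, bitF)
    have a4 := hμ0 (bitF, bitI)
    obtain ⟨l, hl⟩ : ∃ l, l = μ (bitI, bitI) + μ (bitF, bitF) + μ (bitI, bitF)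
      + μ (bitF, bitI) := ⟨_, rfl⟩
    have hl0 : 0 ≤ l := by linarith
    have hl1 : l ≤ 1 := by
      linarith [hμ0 (bitI, bitR0), hμ0 (bitI, bitR1), hμ0 (bitF, bitR0), hμ0 (bitF, bitR1),
        hμ0 (bitR0, bitI), hμ0 (bitR0, bitF), hμ0 (bitR0, bitR0), hμ0 (bitR0, bitR1),
        hμ0 (bitR1, bitI), hμ0 (bitR1, bitF), hμ0 (bitR1, bitR0), hμ0 (bitR1, bitR1)]
    have hb : Q bitI + Q bitF = l * (P bitI + P bitF) := by
      rw [← eI, ← eF, hl]; ring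
    have ha : |Q bitI - Q bitF| ≤ l * |P bitI - P bitF| := by
      have : Q bitI - Q bitF = (μ (bitI, bitI) + μ (bitF, bitF) - μ (bitI, bitF)
          - μ (bitF, bitI)) * (P bitI - P bitF) := by
        rw [← eI, ← eF]; ring
      rw [this, abs_mul]
      refine mul_le_mul_of_nonneg_right ?_ (abs_nonneg _)
      rw [abs_le]; constructor <;> linarith
    have key : ∀ w : ℝ, 0 ≤ w → ∀ x, |x| ≤ 1 → |w * x| ≤ w := by
      intro w hw x hx
      rw [abs_mul, abs_of_nonneg hw]
      nlinarith
    have hc : |Q bitR0 - Q bitR1| ≤ l * |P bitR0 - P bitR1| + (1 - l) := by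
      have b1 := key _ (hμ0 (bitR0, bitI)) ((P bitI - P bitF) + (P bitR0 - P bitR1))
        (by rw [abs_le]; constructor <;> linarith)
      have b2 := key _ (hμ0 (bitR0, bitF)) ((P bitI - P bitF) + (P bitR0 - P bitR1))
        (by rw [abs_le]; constructor <;> linarith)
      have b3 := key _ (hμ0 (bitR1, bitI)) (-(P bitI - P bitF) + (P bitR0 - P bitR1))
        (by rw [abs_le]; constructor <;> linarith)
      have b4 := key _ (hμ0 (bitR1, bitF)) (-(P bitI - P bitF) + (P bitR0 - P bitR1))
        (by rw [abs_le]; constructor <;> linarith)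
      have b5 : |(μ (bitI, bitI) + μ (bitF, bitI) - μ (bitI, bitF) - μ (bitF, bitF))
          * (P bitR0 - P bitR1)| ≤ l * |P bitR0 - P bitR1| := by
        rw [abs_mul]
        refine mul_le_mul_of_nonneg_right ?_ (abs_nonneg _)
        rw [abs_le]; constructor <;> linarith
      have c1 := hμ0 (bitI, bitR0)
      have c2 := hμ0 (bitF, bitR0)
      have c3 := hμ0 (bitR0, bitR0)
      have c4 := hμ0 (bitR1, bitR0)
      have d1 := hμ0 (bitI, bitR1)
      have d2 := hμ0 (bitF, bitR1)
      have d3 := hμ0 (bitR0, bitR1)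
      have d4 := hμ0 (bitR1, bitR1)
      have hd : Q bitR0 - Q bitR1 =
          (μ (bitI, bitI) + μ (bitF, bitI) - μ (bitI, bitF) - μ (bitF, bitF))
            * (P bitR0 - P bitR1)
          + μ (bitR0, bitI) * ((P bitI - P bitF) + (P bitR0 - P bitR1))
          - μ (bitR0, bitF) * ((P bitI - P bitF) + (P bitR0 - P bitR1))
          + μ (bitR1, bitI) * (-(P bitI - P bitF) + (P bitR0 - P bitR1))
          - μ (bitR1, bitF) * (-(P bitI - P bitF) + (P bitR0 - P bitR1))
          + (μ (bitI, bitR0) + μ (bitF, bitR0) + μ (bitR0, bitR0) + μ (bitR1, bitR0))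
          - (μ (bitI, bitR1) + μ (bitF, bitR1) + μ (bitR0, bitR1) + μ (bitR1, bitR1)) := by
        have hp : P bitI = 1 - P bitF - P bitR0 - P bitR1 := by linarith
        rw [← e0, ← e1, hp]; ring
      rw [hd]
      rw [abs_le] at b1 b2 b3 b4 b5 ⊢
      constructor <;> linarith [b1.1, b2.1, b3.1, b4.1, b5.1, b1.2, b2.2, b3.2, b4.2, b5.2]
    have hβ : 0 ≤ P bitI + P bitF := by linarith
    rw [hb]
    refine ⟨by nlinarith, ?_, ?_⟩
    · calc _ ≤ (l * |P bitI - P bitF|) * (P bitI + P bitF) :=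
            mul_le_mul_of_nonneg_right ha hβ
        _ = _ := by ring
    · calc _ = (P bitI + P bitF) * (l * (1 - |P bitR0 - P bitR1|)) := by ring
        _ ≤ _ := mul_le_mul_of_nonneg_left (by linarith) hβ
  · rintro ⟨h1, h2, h3⟩
    have hgQ : |Q bitR0 - Q bitR1| ≤ 1 := by rw [abs_le]; constructor <;> linarith
    obtain ⟨l, hl0, hl1, hb, ha, hc⟩ : ∃ l : ℝ, 0 ≤ l ∧ l ≤ 1 ∧
        Q bitI + Q bitF = l * (P bitI + P bitF) ∧
        |Q bitI - Q bitF| ≤ l * |P bitI - P bitF| ∧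
        |Q bitR0 - Q bitR1| ≤ l * |P bitR0 - P bitR1| + (1 - l) := by
      by_cases hβ : P bitI + P bitF = 0
      · have z1 : Q bitI = 0 := by linarith
        have z2 : Q bitF = 0 := by linarith
        exact ⟨0, le_refl _, zero_le_one, by simp [z1, z2], by simp [z1, z2],
          by linarith⟩
      · have hpos : 0 < P bitI + P bitF := lt_of_le_of_ne (by linarith) (Ne.symm hβ)
        have hb : Q bitI + Q bitF
            = (Q bitI + Q bitF) / (P bitI + P bitF) * (P bitI + P bitF) := by
          field_simp
        have hl0 : 0 ≤ (Q bitI + Q bitF) / (P bitI + P bitF) :=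
          div_nonneg (by linarith) hpos.le
        have hl1 : (Q bitI + Q bitF) / (P bitI + P bitF) ≤ 1 :=
          div_le_one_of_le₀ h1 hpos.le
        generalize (Q bitI + Q bitF) / (P bitI + P bitF) = l at hb hl0 hl1
        rw [hb] at h2 h3
        refine ⟨l, hl0, hl1, hb, ?_, ?_⟩
        · refine le_of_mul_le_mul_right ?_ hpos
          linarith
        · have : l * (1 - |P bitR0 - P bitR1|) ≤ 1 - |Q bitR0 - Q bitR1| := by
            refine le_of_mul_le_mul_left ?_ hpos
            linarith
          linarith
    obtain ⟨a, e, hae, haA, heB⟩ := split_abs _ _ _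
      (mul_nonneg hl0 (abs_nonneg _)) (by linarith) hc
    obtain ⟨u, hu1, hu2, hu⟩ := factor_abs (Q bitI - Q bitF) (l * (P bitI - P bitF))
      (by rwa [abs_mul, abs_of_nonneg hl0])
    obtain ⟨v, hv1, hv2, hv⟩ := factor_abs a (l * (P bitR0 - P bitR1))
      (by rwa [abs_mul, abs_of_nonneg hl0])
    rw [abs_le] at heB
    refine ⟨fun gh =>
      if gh.1 = bitI then
        if gh.2 = bitI then l * (1 + u) * (1 + v) / 4
        else if gh.2 = bitF then l * (1 - u) * (1 - v) / 4
        else if gh.2 = bitR0 then (1 - l + e) / 2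
        else (1 - l - e) / 2
      else if gh.1 = bitF then
        if gh.2 = bitI then l * (1 - u) * (1 + v) / 4
        else if gh.2 = bitF then l * (1 + u) * (1 - v) / 4
        else 0
      else 0, ⟨?_, ?_⟩, ?_⟩
    · have u1 : 0 ≤ 1 + u := by linarith
      have u2 : 0 ≤ 1 - u := by linarith
      have v1 : 0 ≤ 1 + v := by linarith
      have v2 : 0 ≤ 1 - v := by linarith
      have w1 : 0 ≤ 1 - l + e := by linarith
      have w2 : 0 ≤ 1 - l - e := by linarith
      intro gh
      dsimp only
      split_ifs <;> positivity
    · simp only [Fintype.sum_prod_type, sum_bit,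
        nIF, nI0, nI1, nF0, nF1, n01, nFI, n0I, n1I, n0F, n1F, n10, if_true, if_false]
      ring
    · have hall : ∀ G : (Bool → Bool) → ℝ, G bitI = Q bitI → G bitF = Q bitF →
          G bitR0 = Q bitR0 → G bitR1 = Q bitR1 → G = Q := by
        intro G g1 g2 g3 g4
        funext f
        have : f = bitI ∨ f = bitF ∨ f = bitR0 ∨ f = bitR1 := by
          revert f; decide
        rcases this with rfl | rfl | rfl | rfl <;> assumption
      have hp : P bitR0 + P bitR1 = 1 - (P bitI + P bitF) := by linarith
      have hlp : l * (P bitR0 + P bitR1) = l - l * (P bitI + P bitF) := by rw [hp]; ring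
      apply hall <;>
      simp only [Gamma, Fintype.sum_prod_type, sum_bit, cI1, cI2, c01, c11, cFF, cF0, cF1,
        nIF, nI0, nI1, nF0, nF1, n01, nFI, n0I, n1I, n0F, n1F, n10, if_true, if_false,
        add_zero, zero_add, mul_zero, zero_mul, hP1, mul_one]
      · linear_combination (-1/2) * hb + (1/2) * hu
      · linear_combination (-1/2) * hb - (1/2) * hu
      · linear_combination (1/2) * hlp + (1/2) * hv + (1/2) * hb - (1/2) * hae - (1/2) * hQ1
      · linear_combination (1/2) * hlp - (1/2) * hv + (1/2) * hb + (1/2) * hae - (1/2) * hQ1
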